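/- arXiv:2603.21840 — 2 statements merged into one kernel-verified Lean document; each statement's English description precedes it below -/
import Mathlib

section
/- PURE strictly overestimates accuracy: for integers N ≥ 1 and 2 ≤ M ≤ N, the PURE accuracy estimator on samples of accuracy 1 satisfies A^PURE = (1/M) ∑_{m=1}^M (1 + (M−m)/N) > 1, so PURE can exceed 1 and hence does not respect the bound accuracy ∈ [0,1]. -/
open Finset

/-- **PURE strictly overestimates accuracy.**
For integers `N ≥ 1` and `2 ≤ M ≤ N`, the PURE accuracy estimator on samples of
accuracy `1` satisfies `A^PURE = (1/M) ∑_{m=1}^M (1 + (M−m)/N) > 1`, so PURE can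
exceed `1` and hence does not respect the bound `accuracy ∈ [0,1]`. -/
theorem pure_overestimates (N M : ℕ) (hN : 1 ≤ N) (hM : 2 ≤ M) (hMN : M ≤ N) :
    1 < (1 / (M : ℝ)) * ∑ m ∈ Finset.Icc 1 M, (1 + ((M : ℝ) - (m : ℝ)) / (N : ℝ)) := by
  have hN' : (0 : ℝ) < N := by exact_mod_cast hN
  have hM' : (1 : ℝ) < M := by exact_mod_cast hM
  have hsum : ∑ m ∈ Finset.Icc 1 M, (1 : ℝ) <
      ∑ m ∈ Finset.Icc 1 M, (1 + ((M : ℝ) - (m : ℝ)) / (N : ℝ)) := by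
    refine Finset.sum_lt_sum (fun m hm => ?_) ⟨1, Finset.mem_Icc.2 ⟨le_rfl, by lia⟩, ?_⟩
    · have hm' : (m : ℝ) ≤ M := by exact_mod_cast (Finset.mem_Icc.1 hm).2
      exact le_add_of_nonneg_right (div_nonneg (sub_nonneg.2 hm') hN'.le)
    · rw [Nat.cast_one]
      exact lt_add_of_pos_right _ (div_pos (sub_pos.2 hM') hN')
  rw [one_div_mul_eq_div, one_lt_div (by linarith)]
  simpa only [Finset.sum_const, Nat.card_Icc, Nat.add_sub_cancel, nsmul_eq_mul, mul_one] using hsum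
end

section
/- LURE strictly overestimates accuracy: for integers 2 ≤ M < N, the LURE accuracy estimator on samples of accuracy 1 satisfies A^LURE = (1/M) ∑_{m=1}^M [1 + ((N−M)/(N−m)) (N/(N−m+1) − 1)] > 1, so LURE can exceed 1 and hence does not respect the bound accuracy ∈ [0,1]. -/
open Finset

/-- **LURE strictly overestimates accuracy.**
For integers `2 ≤ M < N`, the LURE accuracy estimator on samples of accuracy `1`,
with uniform proposal `q = 1/N`, satisfies
`A^LURE = (1/M) ∑_{m=1}^M [1 + ((N−M)/(N−m)) (N/(N−m+1) − 1)] > 1`,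
so LURE can exceed `1` and hence does not respect the bound `accuracy ∈ [0,1]`. -/
theorem lure_overestimates (N M : ℕ) (hM : 2 ≤ M) (hMN : M < N) :
    1 < (1 / (M : ℝ)) * ∑ m ∈ Finset.Icc 1 M,
        (1 + (((N : ℝ) - (M : ℝ)) / ((N : ℝ) - (m : ℝ)))
              * ((N : ℝ) / ((N : ℝ) - (m : ℝ) + 1) - 1)) := by
  have weight_pos (m : ℕ) (hm : m ≤ M) :
      0 < ((N : ℝ) - M) / (N - m) ∧
        (N : ℝ) / (N - m + 1) - 1 = ((m : ℝ) - 1) / (N - m + 1) := by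
    have hM' : (M : ℝ) < N := by exact_mod_cast hMN
    have hm' : (m : ℝ) ≤ M := by exact_mod_cast hm
    refine ⟨div_pos (by linarith) (by linarith), ?_⟩
    have : (N : ℝ) - m + 1 ≠ 0 := by
      have : (0 : ℝ) < N - m + 1 := by linarith
      exact this.ne'
    field_simp
    ring
  have hMpos : (0 : ℝ) < M := by exact_mod_cast (by omega : 0 < M)
  rw [one_div_mul_eq_div, lt_div_iff₀ hMpos, one_mul]
  calc (M : ℝ) = ∑ _m ∈ Finset.Icc 1 M, (1 : ℝ) := by simp
    _ < _ := by
      have hM' : (M : ℝ) < N := by exact_mod_cast hMN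
      refine Finset.sum_lt_sum (fun m hm => ?_) ⟨2, by simp [hM], ?_⟩
      · obtain ⟨h1, hmM⟩ := Finset.mem_Icc.mp hm
        obtain ⟨hpos, heq⟩ := weight_pos m hmM
        have h1' : (1 : ℝ) ≤ m := by exact_mod_cast h1
        have hm' : (m : ℝ) ≤ M := by exact_mod_cast hmM
        rw [heq]
        exact le_add_of_nonneg_right
          (mul_nonneg hpos.le (div_nonneg (by linarith) (by linarith)))
      · obtain ⟨hpos, heq⟩ := weight_pos 2 hM
        have h2 : ((2 : ℕ) : ℝ) ≤ M := by exact_mod_cast hM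
        rw [heq]
        exact lt_add_of_pos_right _
          (mul_pos hpos (div_pos (by norm_num) (by linarith)))
end
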